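/- Let E be a directed graph. Every nonempty clopen subset of the boundary path space ∂E contains two distinct tail-equivalent boundary paths if and only if E satisfies Conditions (L) and (T). -/

import Mathlib

/-! ## Directed graphs, paths, and the boundary path space -/

/-- A directed graph: edge set `E`, vertex set `V`, source and range maps. -/
structure DGraph (V : Type*) (E : Type*) where
  s : E → V
  r : E → V

variable {V E : Type*}

/-- A finite path in a directed graph: a base (source) vertex together with a finite
sequence of composable edges; vertices are the trivial paths. -/
structure FinPath (G : DGraph V E) where
  src : V
  edges : List E
  src_eq : ∀ e ∈ edges.head?, G.s e = src
  chain : edges.Chain' fun e f => G.r e = G.s f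

namespace FinPath

variable {G : DGraph V E}

/-- The range (terminal vertex) of a finite path. -/
def rng (μ : FinPath G) : V := μ.edges.getLast?.elim μ.src G.r

/-- `μ ≤ ν`: `ν` extends `μ`, i.e. `ν = μλ` for some (possibly trivial) path `λ`. -/
def Le (μ ν : FinPath G) : Prop := μ.src = ν.src ∧ μ.edges <+: ν.edges

/-- Two finite paths are disjoint if neither is an initial segment of the other. -/
def Disjoint (μ ν : FinPath G) : Prop := ¬ Le μ ν ∧ ¬ Le ν μ

/-- A cycle: a nontrivial path returning to its base vertex. -/
def IsCycle (μ : FinPath G) : Prop := μ.edges ≠ [] ∧ μ.rng = μ.src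

/-- A return path: a cycle not passing through its base vertex in between. -/
def IsReturnPath (μ : FinPath G) : Prop :=
  IsCycle μ ∧ ∀ (i : ℕ) (h : i + 1 < μ.edges.length),
    G.r (μ.edges.get ⟨i, Nat.lt_of_succ_lt h⟩) ≠ μ.rng

/-- A path has an exit. -/
def HasExit (μ : FinPath G) : Prop :=
  ∃ (i : Fin μ.edges.length) (e : E),
    G.s e = G.s (μ.edges.get i) ∧ e ≠ μ.edges.get i

end FinPath

/-- The trivial path at a vertex. -/
def trivialPath (G : DGraph V E) (v : V) : FinPath G :=
  ⟨v, [], by intro e he; simp at he, by simp [List.Chain']⟩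

/-- An infinite path in a directed graph. -/
structure InfPath (G : DGraph V E) where
  edges : ℕ → E
  chain : ∀ i, G.r (edges i) = G.s (edges (i + 1))

/-- The source vertex of an infinite path. -/
def InfPath.src {G : DGraph V E} (x : InfPath G) : V := G.s (x.edges 0)

/-- A wandering infinite path: it visits each vertex only finitely often. -/
def Wandering {G : DGraph V E} (x : InfPath G) : Prop :=
  ∀ v : V, {i : ℕ | G.s (x.edges i) = v}.Finite

/-- A semi-tail: a wandering infinite path each of whose edges is the unique edge emitted
by its source. -/
def IsSemiTail {G : DGraph V E} (x : InfPath G) : Prop :=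
  Wandering x ∧ ∀ i, ∀ e : E, G.s e = G.s (x.edges i) → e = x.edges i

/-- A sink: a vertex emitting no edges. -/
def IsSink (G : DGraph V E) (v : V) : Prop := ∀ e : E, G.s e ≠ v

/-- An infinite emitter. -/
def InfEmitter (G : DGraph V E) (v : V) : Prop := {e : E | G.s e = v}.Infinite

/-- A singular vertex: a sink or an infinite emitter. -/
def Singular (G : DGraph V E) (v : V) : Prop := IsSink G v ∨ InfEmitter G v

/-- `v ≥ w`: there is a finite path from `v` to `w`. -/
def Reaches (G : DGraph V E) (v w : V) : Prop :=
  ∃ μ : FinPath G, μ.src = v ∧ μ.rng = w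

/-- Condition (L): every cycle has an exit. -/
def CondL (G : DGraph V E) : Prop :=
  ∀ μ : FinPath G, μ.IsCycle → μ.HasExit

/-- Condition (T): from every vertex there are at least two distinct paths to some common
vertex. -/
def CondT (G : DGraph V E) : Prop :=
  ∀ v : V, ∃ μ ν : FinPath G, μ ≠ ν ∧ μ.src = v ∧ ν.src = v ∧ μ.rng = ν.rng

/-- Condition (K): every vertex supports either no return path or at least two. -/
def CondK (G : DGraph V E) : Prop :=
  ∀ v : V, (¬ ∃ μ : FinPath G, μ.IsReturnPath ∧ μ.src = v) ∨
    (∃ μ ν : FinPath G, μ ≠ ν ∧ μ.IsReturnPath ∧ ν.IsReturnPath ∧ μ.src = v ∧ ν.src = v)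

/-- Condition (W): every wandering infinite path admits a second route from its source to
the range of one of its edges. -/
def CondW (G : DGraph V E) : Prop :=
  ∀ x : InfPath G, Wandering x →
    ∃ (n : ℕ) (μ ν : FinPath G), μ ≠ ν ∧ μ.src = x.src ∧ ν.src = x.src ∧
      μ.rng = G.r (x.edges n) ∧ ν.rng = G.r (x.edges n)

/-- Condition (∞): every infinite emitter emits infinitely many edges whose ranges can
reach back. -/
def CondInf (G : DGraph V E) : Prop :=
  ∀ v : V, InfEmitter G v → {e : E | G.s e = v ∧ Reaches G (G.r e) v}.Infinite

/-- Cofinality: every vertex can reach some vertex on every infinite path. -/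
def Cofinal (G : DGraph V E) : Prop :=
  ∀ (v : V) (x : InfPath G), ∃ n : ℕ, Reaches G v (G.s (x.edges n))

/-- The boundary path space: all infinite paths together with all finite paths ending at a
singular vertex. -/
def BPath (G : DGraph V E) : Type _ :=
  {μ : FinPath G // Singular G μ.rng} ⊕ InfPath G

namespace BPath

variable {G : DGraph V E}

/-- The source vertex of a boundary path. -/
def src : BPath G → V
  | Sum.inl p => p.1.src
  | Sum.inr x => x.src

/-- The `n`-th edge of a boundary path (0-indexed), if it exists. -/
def edgeAt : BPath G → ℕ → Option E
  | Sum.inl p, n => p.1.edges[n]?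
  | Sum.inr x, n => some (x.edges n)

end BPath

/-- A finite path `μ` is an initial segment of a boundary path `p`. -/
def IsPrefixOf {G : DGraph V E} (μ : FinPath G) (p : BPath G) : Prop :=
  μ.src = p.src ∧ ∀ i, i < μ.edges.length → p.edgeAt i = μ.edges[i]?

/-- The cylinder set `Z(μ)` of a finite path. -/
def ZSet {G : DGraph V E} (μ : FinPath G) : Set (BPath G) :=
  {p | IsPrefixOf μ p}

/-- The basic set `Z(μ∖F) = Z(μ) ∖ ⋃_{e ∈ F} Z(μe)`. -/
def ZMinus {G : DGraph V E} (μ : FinPath G) (F : Set E) : Set (BPath G) :=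
  {p | IsPrefixOf μ p ∧ ∀ e ∈ F, p.edgeAt μ.edges.length ≠ some e}

/-- The topology on the boundary path space generated by the basic sets `Z(μ∖F)`. -/
instance bpathTopology {G : DGraph V E} : TopologicalSpace (BPath G) :=
  TopologicalSpace.generateFrom
    {S | ∃ (μ : FinPath G) (F : Set E), F.Finite ∧ (∀ e ∈ F, G.s e = μ.rng) ∧ S = ZMinus μ F}

/-- Tail equivalence of boundary paths. -/
def TailEquiv {G : DGraph V E} : BPath G → BPath G → Prop
  | Sum.inl p, Sum.inl q => p.1.rng = q.1.rng
  | Sum.inr x, Sum.inr y => ∃ k l : ℕ, ∀ n : ℕ, x.edges (k + n) = y.edges (l + n)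
  | Sum.inl _, Sum.inr _ => False
  | Sum.inr _, Sum.inl _ => False

/-- `l` is the edge list of a path from `v` to `w`. -/
def IsP (G : DGraph V E) : V → List E → V → Prop
  | v, [], w => v = w
  | v, e :: l, w => G.s e = v ∧ IsP G (G.r e) l w

theorem IsP.append_iff {G : DGraph V E} {v w : V} {l m : List E} :
    IsP G v (l ++ m) w ↔ ∃ u, IsP G v l u ∧ IsP G u m w := by
  induction l generalizing v with
  | nil => simp [IsP]
  | cons e l ih => simp [IsP, ih, and_assoc]

theorem isP_aux {G : DGraph V E} (l : List E) : ∀ (v : V), (∀ e ∈ l.head?, G.s e = v) →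
    (l.IsChain fun e f => G.r e = G.s f) → IsP G v l (l.getLast?.elim v G.r) := by
  induction l with
  | nil => intro v _ _; simp [IsP]
  | cons e l ih =>
    intro v h1 h2
    refine ⟨h1 e (by simp), ?_⟩
    rw [List.isChain_cons] at h2
    have := ih (G.r e) (fun f hf => (h2.1 f hf).symm) h2.2
    cases l with
    | nil => simp [IsP]
    | cons f l => simpa [List.getLast?_cons_cons, List.getLast?_cons] using this

theorem FinPath.isP {G : DGraph V E} (μ : FinPath G) : IsP G μ.src μ.edges μ.rng :=
  isP_aux _ _ μ.src_eq μ.chain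

theorem IsP.head {G : DGraph V E} {v w : V} {l : List E} (h : IsP G v l w) :
    ∀ e ∈ l.head?, G.s e = v := by
  cases l with
  | nil => simp
  | cons e l => intro f hf; simp at hf; subst hf; exact h.1

theorem IsP.isChain {G : DGraph V E} {v w : V} {l : List E} (h : IsP G v l w) :
    l.IsChain fun e f => G.r e = G.s f := by
  induction l generalizing v with
  | nil => simp
  | cons e l ih =>
    rw [List.isChain_cons]
    exact ⟨fun f hf => (h.2.head f hf).symm, ih h.2⟩

theorem IsP.unique {G : DGraph V E} {v w u : V} {l : List E} (h : IsP G v l w)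
    (h' : IsP G v l u) : w = u := by
  induction l generalizing v with
  | nil => exact h.symm.trans h'
  | cons e l ih => exact ih h.2 h'.2

theorem IsP.toFin {G : DGraph V E} {v w : V} {l : List E} (h : IsP G v l w) :
    ∃ μ : FinPath G, μ.src = v ∧ μ.edges = l ∧ μ.rng = w := by
  refine ⟨⟨v, l, h.head, h.isChain⟩, rfl, rfl, ?_⟩
  exact IsP.unique (FinPath.isP (⟨v, l, h.head, h.isChain⟩ : FinPath G)) h

theorem isP_inf {G : DGraph V E} (x : InfPath G) (n : ℕ) :
    IsP G x.src ((List.range n).map x.edges) (G.s (x.edges n)) := by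
  induction n with
  | zero => simp [IsP, InfPath.src]
  | succ n ih =>
    rw [List.range_succ, List.map_append, IsP.append_iff]
    exact ⟨_, ih, rfl, x.chain n⟩

/-- Every vertex is the source of a boundary path. -/
theorem exists_bpath (G : DGraph V E) (v : V) : ∃ p : BPath G, p.src = v := by
  by_cases h : ∃ l w, IsP G v l w ∧ IsSink G w
  · obtain ⟨l, w, h, hw⟩ := h
    obtain ⟨μ, h1, h2, h3⟩ := h.toFin
    exact ⟨Sum.inl ⟨μ, Or.inl (h3 ▸ hw)⟩, h1⟩
  · push Not at h
    have key : ∀ w : V, (∃ l, IsP G v l w) → ∃ e, G.s e = w := by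
      rintro w ⟨l, hl⟩
      have := h l w hl
      simpa [IsSink] using this
    obtain ⟨e0, he0⟩ := key v ⟨[], rfl⟩
    haveI : Nonempty E := ⟨e0⟩
    choose! f hf using key
    let vs : ℕ → V := fun n => Nat.rec v (fun _ w => G.r (f w)) n
    have hvs : ∀ n, ∃ l, IsP G v l (vs n) := by
      intro n
      induction n with
      | zero => exact ⟨[], rfl⟩
      | succ n ih =>
        have ih' := ih
        obtain ⟨l, hl⟩ := ih
        exact ⟨l ++ [f (vs n)], IsP.append_iff.2 ⟨_, hl, hf _ ih', rfl⟩⟩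
    exact ⟨Sum.inr ⟨fun n => f (vs n), fun i => (hf _ (hvs (i+1))).symm⟩, hf _ (hvs 0)⟩

theorem BPath.ext' {G : DGraph V E} {p q : BPath G} (hs : p.src = q.src)
    (h : ∀ n, p.edgeAt n = q.edgeAt n) : p = q := by
  rcases p with ⟨p, hp⟩ | x <;> rcases q with ⟨q, hq⟩ | y
  · rcases p with ⟨a, l, _, _⟩
    rcases q with ⟨b, m, _, _⟩
    have h1 : a = b := hs
    have h2 : l = m := List.ext_getElem? h
    subst h1 h2
    rfl
  · have := h p.edges.length
    simp [BPath.edgeAt] at this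
  · have := h q.edges.length
    simp [BPath.edgeAt] at this
  · rcases x with ⟨x, _⟩
    rcases y with ⟨y, _⟩
    have : x = y := funext fun n => Option.some.inj (h n)
    subst this
    rfl

theorem TailEquiv.symm' {G : DGraph V E} {p q : BPath G} (h : TailEquiv p q) :
    TailEquiv q p := by
  rcases p with p | x <;> rcases q with q | y
  · exact Eq.symm h
  · exact h
  · exact h
  · obtain ⟨k, l, h⟩ := h
    exact ⟨l, k, fun n => (h n).symm⟩

theorem TailEquiv.trans' {G : DGraph V E} {p q t : BPath G} (h : TailEquiv p q)
    (h' : TailEquiv q t) : TailEquiv p t := by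
  rcases p with p | x <;> rcases q with q | y <;> rcases t with t | z <;>
    first
    | exact h.elim
    | exact h'.elim
    | exact Eq.trans h h'
    | skip
  obtain ⟨k, l, h⟩ := h
  obtain ⟨k', l', h'⟩ := h'
  refine ⟨k + k', l' + l, fun n => ?_⟩
  rw [add_assoc, h, add_assoc, ← h']
  congr 1
  omega

theorem TailEquiv.refl' {G : DGraph V E} (p : BPath G) : TailEquiv p p := by
  rcases p with p | x
  · exact rfl
  · exact ⟨0, 0, fun n => rfl⟩

theorem exists_cons {G : DGraph V E} (e : E) (p : BPath G) (h : p.src = G.r e) :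
    ∃ q : BPath G, q.src = G.s e ∧ q.edgeAt 0 = some e ∧
      (∀ n, q.edgeAt (n + 1) = p.edgeAt n) ∧ TailEquiv q p := by
  rcases p with ⟨p, hp⟩ | x
  · have h' : IsP G (G.s e) (e :: p.edges) p.rng := ⟨rfl, by
      have := p.isP
      rwa [show p.src = G.r e from h] at this⟩
    obtain ⟨μ, h1, h2, h3⟩ := h'.toFin
    refine ⟨Sum.inl ⟨μ, h3 ▸ hp⟩, h1, ?_, ?_, h3⟩
    · simp [BPath.edgeAt, h2]
    · simp [BPath.edgeAt, h2]
  · refine ⟨Sum.inr ⟨fun n => Nat.casesOn n e x.edges, ?_⟩, rfl, rfl, fun n => rfl, 1, 0, ?_⟩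
    · intro i
      cases i with
      | zero => exact h.symm
      | succ i => exact x.chain i
    · intro n
      rw [add_comm 1 n, zero_add]

theorem exists_append {G : DGraph V E} (l : List E) : ∀ (v w : V) (p : BPath G),
    IsP G v l w → p.src = w →
    ∃ q : BPath G, q.src = v ∧ (∀ i, i < l.length → q.edgeAt i = l[i]?) ∧
      (∀ n, q.edgeAt (l.length + n) = p.edgeAt n) ∧ TailEquiv q p := by
  induction l with
  | nil =>
    intro v w p h hp
    exact ⟨p, hp.trans (Eq.symm h), by simp, by simp, TailEquiv.refl' p⟩
  | cons e l ih =>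
    intro v w p h hp
    obtain ⟨q, h1, h2, h3, h4⟩ := ih _ _ p h.2 hp
    obtain ⟨t, g1, g2, g3, g4⟩ := exists_cons e q h1
    refine ⟨t, g1.trans h.1, ?_, ?_, g4.trans' h4⟩
    · intro i hi
      cases i with
      | zero => simpa using g2
      | succ i =>
        rw [g3, h2 i (by simpa using hi)]
        simp
    · intro n
      rw [List.length_cons, show l.length + 1 + n = (l.length + n) + 1 by omega, g3, h3]

theorem open_inf {G : DGraph V E} {A : Set (BPath G)} (hA : IsOpen A) :
    ∀ x : InfPath G, (Sum.inr x : BPath G) ∈ A → ∃ n : ℕ, ∀ q : BPath G, q.src = x.src →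
      (∀ i, i < n → q.edgeAt i = some (x.edges i)) → q ∈ A := by
  induction hA with
  | basic S hS =>
    obtain ⟨μ, F, -, -, rfl⟩ := hS
    rintro x ⟨⟨h1, h2⟩, h3⟩
    refine ⟨μ.edges.length + 1, fun q hq hi => ⟨⟨h1.trans hq.symm, fun i hl => ?_⟩, ?_⟩⟩
    · rw [hi i (by omega), ← h2 i hl]; rfl
    · intro e he
      rw [hi _ (by omega)]
      exact h3 e he
  | univ => intro x _; exact ⟨0, fun _ _ _ => trivial⟩
  | inter s t _ _ ihs iht =>
    intro x hx
    obtain ⟨n, hn⟩ := ihs x hx.1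
    obtain ⟨m, hm⟩ := iht x hx.2
    exact ⟨max n m, fun q hq h => ⟨hn q hq fun i hi => h i (by omega),
      hm q hq fun i hi => h i (by omega)⟩⟩
  | sUnion S _ ih =>
    rintro x ⟨s, hs, hx⟩
    obtain ⟨n, hn⟩ := ih s hs x hx
    exact ⟨n, fun q hq h => ⟨s, hs, hn q hq h⟩⟩

theorem open_fin {G : DGraph V E} {A : Set (BPath G)} (hA : IsOpen A) :
    ∀ p : {μ : FinPath G // Singular G μ.rng}, (Sum.inl p : BPath G) ∈ A →
      ∃ F : Set E, F.Finite ∧ ∀ q : BPath G, q.src = p.1.src →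
      (∀ i, i < p.1.edges.length → q.edgeAt i = p.1.edges[i]?) →
      (∀ e ∈ F, q.edgeAt p.1.edges.length ≠ some e) → q ∈ A := by
  induction hA with
  | basic S hS =>
    obtain ⟨μ, F, hF, -, rfl⟩ := hS
    rintro ⟨p, hp⟩ ⟨⟨h1, h2⟩, h3⟩
    have hlen : μ.edges.length ≤ p.edges.length := by
      by_contra hlt
      push Not at hlt
      have := h2 _ hlt
      simp [BPath.edgeAt] at this
      omega
    refine ⟨F, hF, fun q hq hi hf => ⟨⟨h1.trans hq.symm, fun i hl => ?_⟩, ?_⟩⟩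
    · rw [hi i (by simp; omega), ← h2 i hl]; rfl
    · intro e he
      rcases hlen.lt_or_eq with hlt | heq
      · rw [hi _ hlt]
        exact h3 e he
      · rw [heq]
        exact hf e he
  | univ => intro x _; exact ⟨∅, Set.finite_empty, fun _ _ _ _ => trivial⟩
  | inter s t _ _ ihs iht =>
    intro x hx
    obtain ⟨n, hf, hn⟩ := ihs x hx.1
    obtain ⟨m, hf', hm⟩ := iht x hx.2
    exact ⟨n ∪ m, hf.union hf', fun q hq h h' => ⟨hn q hq h fun e he => h' e (Or.inl he),
      hm q hq h fun e he => h' e (Or.inr he)⟩⟩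
  | sUnion S _ ih =>
    rintro x ⟨s, hs, hx⟩
    obtain ⟨n, hf, hn⟩ := ih s hs x hx
    exact ⟨n, hf, fun q hq h h' => ⟨s, hs, hn q hq h h'⟩⟩

theorem exists_cyl {G : DGraph V E} (hG : ∀ v, ¬ IsSink G v) {A : Set (BPath G)}
    (hA : IsOpen A) (hne : A.Nonempty) : ∃ v l w, IsP G v l w ∧
      ∀ q : BPath G, q.src = v → (∀ i, i < l.length → q.edgeAt i = l[i]?) → q ∈ A := by
  obtain ⟨p | x, hp⟩ := hne
  · obtain ⟨F, hF, h⟩ := open_fin hA p hp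
    have hinf : InfEmitter G p.1.rng := p.2.resolve_left (hG _)
    obtain ⟨e, he, heF⟩ := (Set.Infinite.diff hinf hF).nonempty
    refine ⟨p.1.src, p.1.edges ++ [e], G.r e,
      IsP.append_iff.2 ⟨_, p.1.isP, he, rfl⟩, fun q hq hi => h q hq ?_ ?_⟩
    · intro i hl
      rw [hi i (by simp; omega), List.getElem?_append_left hl]
    · intro f hf
      rw [hi _ (by simp)]
      simp
      rintro rfl
      exact heF hf
  · obtain ⟨n, h⟩ := open_inf hA x hp
    refine ⟨_, _, _, isP_inf x n, fun q hq hi => h q hq fun i hl => ?_⟩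
    rw [hi i (by simpa using hl)]
    simp [hl]

theorem BPath.next_src {G : DGraph V E} (p : BPath G) :
    (∀ f, p.edgeAt 0 = some f → G.s f = p.src) ∧ (p.edgeAt 0 = none → Singular G p.src) := by
  rcases p with ⟨p, hp⟩ | x
  · refine ⟨fun f hf => p.src_eq f ?_, fun h => ?_⟩
    · simpa [BPath.edgeAt, List.head?_eq_getElem?] using hf
    · have h' : p.edges = [] := by simpa [BPath.edgeAt] using h
      change Singular G p.src
      simpa [FinPath.rng, h'] using hp
  · refine ⟨fun f hf => ?_, fun h => ?_⟩
    · have := Option.some.inj hf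
      subst this; rfl
    · cases h

theorem BPath.next_succ {G : DGraph V E} (p : BPath G) (n : ℕ) (e : E)
    (he : p.edgeAt n = some e) :
    (∀ f, p.edgeAt (n + 1) = some f → G.s f = G.r e) ∧
      (p.edgeAt (n + 1) = none → Singular G (G.r e)) := by
  rcases p with ⟨p, hp⟩ | x
  · have he' : p.edges[n]? = some e := he
    obtain ⟨hn, hne⟩ := List.getElem?_eq_some_iff.1 he'
    refine ⟨fun f hf => ?_, fun h => ?_⟩
    · have hf' : p.edges[n+1]? = some f := hf
      obtain ⟨hm, hme⟩ := List.getElem?_eq_some_iff.1 hf'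
      have := List.isChain_iff_getElem.1 p.chain n hm
      rw [← hne, ← hme, this]
    · have h' : p.edges.length ≤ n + 1 := by simpa [BPath.edgeAt] using h
      have hl : p.edges.getLast? = some e := by
        rw [List.getLast?_eq_getElem?, ← he']
        congr 1
        omega
      simpa [FinPath.rng, hl] using hp
  · have := Option.some.inj he
    subst this
    refine ⟨fun f hf => ?_, fun h => ?_⟩
    · have := Option.some.inj hf
      subst this
      exact (x.chain n).symm
    · cases h

theorem isClopen_src (G : DGraph V E) (v : V) : IsClopen {p : BPath G | p.src = v} := by
  have hop : ∀ w, IsOpen {p : BPath G | p.src = w} := by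
    intro w
    refine TopologicalSpace.isOpen_generateFrom_of_mem
      ⟨trivialPath G w, ∅, Set.finite_empty, by simp, ?_⟩
    ext p
    simp [ZMinus, IsPrefixOf, trivialPath, eq_comm]
  refine ⟨⟨?_⟩, hop v⟩
  have : {p : BPath G | p.src = v}ᶜ = ⋃ w : {w // w ≠ v}, {p : BPath G | p.src = w.1} := by
    ext p
    simp
  rw [this]
  exact isOpen_iUnion fun w => hop _

theorem not_singular_of_unique {G : DGraph V E} {v : V} {e : E} (he : G.s e = v)
    (h : ∀ f, G.s f = v → f = e) : ¬ Singular G v := by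
  rintro (h1 | h1)
  · exact h1 e he
  · exact h1 ((Set.finite_singleton e).subset fun f hf => h f hf)

theorem noexit_edge {G : DGraph V E} (μ : FinPath G) (hc : μ.IsCycle) (hx : ¬ μ.HasExit)
    (p : BPath G) (hp : p.src = μ.src) (n : ℕ) :
    p.edgeAt n = μ.edges[n % μ.edges.length]? := by
  have hpos : 0 < μ.edges.length := List.length_pos_iff.2 hc.1
  have huniq : ∀ (i : ℕ) (hi : i < μ.edges.length) (f : E),
      G.s f = G.s μ.edges[i] → f = μ.edges[i] := by
    intro i hi f hf
    by_contra hne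
    exact hx ⟨⟨i, hi⟩, f, hf, hne⟩
  have hs0 : G.s μ.edges[0] = μ.src := μ.src_eq _ (by
    simp [List.head?_eq_getElem?, hpos])
  induction n with
  | zero =>
    rw [Nat.zero_mod, List.getElem?_eq_getElem hpos]
    cases h : p.edgeAt 0 with
    | none =>
      have := p.next_src.2 h
      rw [hp, ← hs0] at this
      exact (not_singular_of_unique rfl (huniq 0 hpos) this).elim
    | some f =>
      have := p.next_src.1 f h
      rw [hp, ← hs0] at this
      rw [huniq 0 hpos f this]
  | succ n ih =>
    have hi : n % μ.edges.length < μ.edges.length := Nat.mod_lt _ hpos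
    have hi' : (n + 1) % μ.edges.length < μ.edges.length := Nat.mod_lt _ hpos
    rw [List.getElem?_eq_getElem hi] at ih
    rw [List.getElem?_eq_getElem hi']
    have hr : G.r μ.edges[n % μ.edges.length] = G.s μ.edges[(n + 1) % μ.edges.length] := by
      by_cases hlt : n % μ.edges.length + 1 < μ.edges.length
      · have e1 : (n + 1) % μ.edges.length = n % μ.edges.length + 1 := by
          rw [← Nat.mod_add_mod, Nat.mod_eq_of_lt hlt]
        simp only [e1]
        exact List.isChain_iff_getElem.1 μ.chain _ hlt
      · have e2 : n % μ.edges.length + 1 = μ.edges.length := by omega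
        have e1 : (n + 1) % μ.edges.length = 0 := by
          rw [← Nat.mod_add_mod, e2, Nat.mod_self]
        simp only [e1]
        rw [hs0, ← hc.2]
        have e3 : μ.edges.getLast? = some (μ.edges[n % μ.edges.length]) := by
          rw [List.getLast?_eq_getElem?, ← List.getElem?_eq_getElem hi]
          congr 1
          omega
        simp [FinPath.rng, e3]
    cases h : p.edgeAt (n + 1) with
    | none =>
      have := (p.next_succ n _ ih).2 h
      rw [hr] at this
      exact (not_singular_of_unique rfl (huniq _ hi') this).elim
    | some f =>
      have := (p.next_succ n _ ih).1 f h
      rw [hr] at this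
      rw [huniq _ hi' f this]

/-- Two distinct parallel paths admit a continuation that tells them apart. -/
theorem exists_sep {G : DGraph V E} (hL : CondL G) {u w : V} {a b : List E}
    (ha : IsP G u a w) (hb : IsP G u b w) (hab : a ≠ b) (hle : a.length ≤ b.length) :
    ∃ x : BPath G, x.src = w ∧ ∃ i, (if i < a.length then a[i]? else x.edgeAt (i - a.length)) ≠
      (if i < b.length then b[i]? else x.edgeAt (i - b.length)) := by
  by_cases hpre : a <+: b
  · obtain ⟨c, rfl⟩ := hpre
    obtain ⟨w', h1, h2⟩ := IsP.append_iff.1 hb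
    obtain rfl := ha.unique h1
    have hc : c ≠ [] := by rintro rfl; simp at hab
    obtain ⟨γ, g1, rfl, g3⟩ := h2.toFin
    obtain ⟨⟨i, hi⟩, e, he, hne⟩ := hL γ ⟨hc, g3.trans g1.symm⟩
    simp only [List.get_eq_getElem] at he hne
    obtain ⟨y, hy⟩ := exists_bpath G (G.r e)
    have hsplit : γ.edges = γ.edges.take i ++ γ.edges[i] :: γ.edges.drop (i + 1) := by
      rw [List.getElem_cons_drop, List.take_append_drop]
    rw [hsplit] at h2
    obtain ⟨z, hz1, hz2⟩ := IsP.append_iff.1 h2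
    have hP : IsP G w (γ.edges.take i ++ [e]) (G.r e) :=
      IsP.append_iff.2 ⟨z, hz1, he.trans hz2.1, rfl⟩
    obtain ⟨x, hx1, hx2, -, -⟩ := exists_append _ _ _ y hP hy
    refine ⟨x, hx1, a.length + i, ?_⟩
    have hx := hx2 i (by simp; omega)
    have hmin : min i γ.edges.length = i := by omega
    rw [if_neg (by omega), if_pos (by simp; omega), Nat.add_sub_cancel_left, hx]
    rw [List.getElem?_append_right (by simp), List.getElem?_append_right (by simp)]
    simp [hmin, List.getElem?_eq_getElem hi, hne]
  · obtain ⟨x, hx⟩ := exists_bpath G w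
    refine ⟨x, hx, ?_⟩
    by_contra hcon
    push Not at hcon
    apply hpre
    rw [List.prefix_iff_getElem?]
    intro i hi
    have := hcon i
    rw [if_pos hi, if_pos (by omega)] at this
    rw [← this, List.getElem?_eq_getElem hi]

theorem statement5 (G : DGraph V E) :
    (∀ A : Set (BPath G), IsClopen A → A.Nonempty →
      ∃ p ∈ A, ∃ q ∈ A, p ≠ q ∧ TailEquiv p q) ↔ (CondL G ∧ CondT G) := by
  constructor
  · intro H
    have H' : ∀ v : V, ∃ p q : BPath G, p.src = v ∧ q.src = v ∧ p ≠ q ∧ TailEquiv p q := by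
      intro v
      obtain ⟨p, hp, q, hq, h⟩ := H _ (isClopen_src G v) (exists_bpath G v)
      exact ⟨p, q, hp, hq, h⟩
    refine ⟨fun μ hμ => ?_, fun v => ?_⟩
    · by_contra hx
      obtain ⟨p, q, hp, hq, hne, -⟩ := H' μ.src
      apply hne
      refine BPath.ext' (hp.trans hq.symm) fun n => ?_
      rw [noexit_edge μ hμ hx p hp, noexit_edge μ hμ hx q hq]
    · obtain ⟨p, q, hp, hq, hne, ht⟩ := H' v
      rcases p with p | x <;> rcases q with q | y
      · refine ⟨p.1, q.1, ?_, hp, hq, ht⟩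
        intro h
        exact hne (congrArg Sum.inl (Subtype.ext h))
      · exact ht.elim
      · exact ht.elim
      · obtain ⟨k, l, h⟩ := ht
        obtain ⟨μ, m1, m2, m3⟩ := (isP_inf x k).toFin
        obtain ⟨ν, n1, n2, n3⟩ := (isP_inf y l).toFin
        refine ⟨μ, ν, ?_, m1.trans hp, n1.trans hq, ?_⟩
        · rintro rfl
          apply hne
          have heq := m2.symm.trans n2
          have hkl : k = l := by simpa using congrArg List.length heq
          subst hkl
          refine BPath.ext' (hp.trans hq.symm) fun n => congrArg some ?_
          by_cases hn : n < k
          · exact List.map_inj_left.1 heq n (by simpa using hn)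
          · have := h (n - k)
            rwa [show k + (n - k) = n by omega] at this
        · rw [m3, n3]
          have := h 0
          rw [add_zero, add_zero] at this
          rw [this]
  · rintro ⟨hL, hT⟩ A hA hne
    have hsink : ∀ v, ¬ IsSink G v := by
      intro v hv
      obtain ⟨μ, ν, hne, h1, h2, -⟩ := hT v
      have key : ∀ μ : FinPath G, μ.src = v → μ.edges = [] := by
        intro μ h
        cases hl : μ.edges with
        | nil => rfl
        | cons e l => exact (hv e ((μ.src_eq e (by simp [hl])).trans h)).elim
      apply hne
      have e1 := key μ h1
      have e2 := key ν h2
      rcases μ with ⟨_, _, _, _⟩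
      rcases ν with ⟨_, _, _, _⟩
      simp_all
    obtain ⟨v, l, u, hl, hcyl⟩ := exists_cyl hsink hA.isOpen hne
    obtain ⟨μ, ν, hμν, h1, h2, h3⟩ := hT u
    have hsep : ∃ a b : List E, ∃ w, IsP G u a w ∧ IsP G u b w ∧ a ≠ b ∧
        a.length ≤ b.length := by
      have hne' : μ.edges ≠ ν.edges := by
        intro h
        apply hμν
        rcases μ with ⟨_, _, _, _⟩
        rcases ν with ⟨_, _, _, _⟩
        simp_all
      have hm := μ.isP
      have hn := ν.isP
      rw [h1] at hm
      rw [h2, ← h3] at hn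
      rcases le_total μ.edges.length ν.edges.length with h | h
      · exact ⟨_, _, _, hm, hn, hne', h⟩
      · exact ⟨_, _, _, hn, hm, hne'.symm, h⟩
    obtain ⟨a, b, w, ha, hb, hab, hle⟩ := hsep
    obtain ⟨x, hx, i, hi⟩ := exists_sep hL ha hb hab hle
    obtain ⟨p, p1, p2, p3, p4⟩ := exists_append a _ _ x ha hx
    obtain ⟨q, q1, q2, q3, q4⟩ := exists_append b _ _ x hb hx
    obtain ⟨p', p1', p2', p3', p4'⟩ := exists_append l _ _ p hl p1
    obtain ⟨q', q1', q2', q3', q4'⟩ := exists_append l _ _ q hl q1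
    refine ⟨p', hcyl p' p1' p2', q', hcyl q' q1' q2', ?_,
      (p4'.trans' p4).trans' (q4'.trans' q4).symm'⟩
    rintro rfl
    apply hi
    have e : p.edgeAt i = q.edgeAt i := by rw [← p3', ← q3']
    have ep : p.edgeAt i = if i < a.length then a[i]? else x.edgeAt (i - a.length) := by
      split_ifs with hh
      · exact p2 i hh
      · rw [← p3, show a.length + (i - a.length) = i by omega]
    have eq : q.edgeAt i = if i < b.length then b[i]? else x.edgeAt (i - b.length) := by
      split_ifs with hh
      · exact q2 i hh
      · rw [← q3, show b.length + (i - b.length) = i by omega]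
    rw [← ep, ← eq, e]
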